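/- arXiv:2109.12805 — 11 statements merged into one kernel-verified Lean document; each statement's English description precedes it below -/
import Mathlib

section
/- Let A be the adjacency matrix of a proper divisible design graph with parameters (v, k, λ₁, λ₂, m, n), i.e. λ₁ ≠ λ₂. Then every real eigenvalue θ of A satisfies θ = k, or θ² = k − λ₁, or θ² = k² − λ₂·v. -/
open Matrix Kronecker

/-- The all-ones matrix. -/
def allOnes (ι : Type*) : Matrix ι ι ℝ := Matrix.of fun _ _ => 1

/-- `A` is the adjacency matrix of a divisible design graph whose canonical
partition has classes indexed by `cl` and class members indexed by `pt`. -/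
def IsDDGAdj {cl pt : Type*} [Fintype cl] [DecidableEq cl] [Fintype pt] [DecidableEq pt]
    (k l1 l2 : ℝ) (A : Matrix (cl × pt) (cl × pt) ℝ) : Prop :=
  A.IsSymm ∧ (∀ x y, A x y = 0 ∨ A x y = 1) ∧ (∀ x, A x x = 0) ∧
  A * A = k • (1 : Matrix (cl × pt) (cl × pt) ℝ)
      + l1 • ((1 : Matrix cl cl ℝ) ⊗ₖ allOnes pt - 1)
      + l2 • (allOnes (cl × pt) - (1 : Matrix cl cl ℝ) ⊗ₖ allOnes pt)

lemma one_kronecker_allOnes_mulVec {cl pt : Type*} [Fintype cl] [DecidableEq cl] [Fintype pt]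
    (x : cl × pt → ℝ) (p : cl × pt) :
    (((1 : Matrix cl cl ℝ) ⊗ₖ allOnes pt).mulVec x) p = ∑ b, x (p.1, b) := by
  simp [Matrix.mulVec, dotProduct, Fintype.sum_prod_type, Matrix.one_apply, allOnes]
  rw [Finset.sum_comm]
  simp

lemma allOnes_mulVec {ι : Type*} [Fintype ι] (x : ι → ℝ) (p : ι) :
    ((allOnes ι).mulVec x) p = ∑ q, x q := by
  simp [Matrix.mulVec, dotProduct, allOnes]

section

variable {cl pt : Type*} [Fintype cl] [DecidableEq cl] [Fintype pt] [DecidableEq pt]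
  {k l1 l2 : ℝ} {A : Matrix (cl × pt) (cl × pt) ℝ}

/-- The square of a divisible design graph acts on a vector through its entries, its class sums
and its total sum. -/
lemma IsDDGAdj.mulVec_mulVec_apply (hA : IsDDGAdj k l1 l2 A) (x : cl × pt → ℝ) (p : cl × pt) :
    A.mulVec (A.mulVec x) p =
      k * x p + l1 * (∑ b, x (p.1, b) - x p) + l2 * (∑ q, x q - ∑ b, x (p.1, b)) := by
  rw [Matrix.mulVec_mulVec, hA.2.2.2]
  simp only [Matrix.add_mulVec, Matrix.sub_mulVec, Matrix.smul_mulVec, Matrix.one_mulVec,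
    Pi.add_apply, Pi.sub_apply, Pi.smul_apply, smul_eq_mul, one_kronecker_allOnes_mulVec,
    allOnes_mulVec]

/-- A divisible design graph is regular of degree `k`. -/
lemma IsDDGAdj.sum_row (hA : IsDDGAdj k l1 l2 A) (p : cl × pt) : ∑ q, A p q = k := by
  have hdiag : (A * A) p p = k := by
    rw [hA.2.2.2]
    simp [allOnes]
  rw [← hdiag, Matrix.mul_apply]
  refine Finset.sum_congr rfl fun q _ => ?_
  rw [hA.1.apply p q]
  rcases hA.2.1 p q with h | h <;> simp [h]

lemma IsDDGAdj.mulVec_one (hA : IsDDGAdj k l1 l2 A) : A.mulVec 1 = k • (1 : cl × pt → ℝ) := by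
  ext p
  simpa [Matrix.mulVec, dotProduct] using hA.sum_row p

lemma IsDDGAdj.sum_mulVec (hA : IsDDGAdj k l1 l2 A) (x : cl × pt → ℝ) :
    ∑ p, A.mulVec x p = k * ∑ p, x p := by
  simp only [Matrix.mulVec, dotProduct]
  rw [Finset.sum_comm, Finset.mul_sum]
  refine Finset.sum_congr rfl fun q _ => ?_
  rw [← Finset.sum_mul, ← hA.sum_row q]
  simp only [hA.1.apply]

/-- Counting walks of length two from a vertex. -/
lemma IsDDGAdj.sq_degree [Nonempty cl] [Nonempty pt] (hA : IsDDGAdj k l1 l2 A) :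
    k ^ 2 = k + l1 * (Fintype.card pt - 1) +
      l2 * (Fintype.card cl * Fintype.card pt - Fintype.card pt) := by
  have h := hA.mulVec_mulVec_apply 1 (Classical.arbitrary _)
  rw [hA.mulVec_one, Matrix.mulVec_smul, hA.mulVec_one] at h
  simpa [sq] using h

end

/-- Every real eigenvalue `θ` of the adjacency matrix of a proper divisible design graph
with parameters `(v, k, λ₁, λ₂, m, n)` satisfies `θ = k`, `θ² = k − λ₁`,
or `θ² = k² − λ₂·v`. -/
theorem ddg_eigenvalues (m n : ℕ) (hm : 0 < m) (hn : 0 < n)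
    (k l1 l2 : ℕ) (A : Matrix (Fin m × Fin n) (Fin m × Fin n) ℝ)
    (hA : IsDDGAdj (k : ℝ) (l1 : ℝ) (l2 : ℝ) A) (hproper : l1 ≠ l2)
    (θ : ℝ) (x : (Fin m × Fin n) → ℝ) (hx : x ≠ 0) (hev : A.mulVec x = θ • x) :
    θ = (k : ℝ) ∨ θ ^ 2 = (k : ℝ) - (l1 : ℝ) ∨ θ ^ 2 = (k : ℝ) ^ 2 - (l2 : ℝ) * ((m * n : ℕ) : ℝ) := by
  have hm' : Nonempty (Fin m) := ⟨⟨0, hm⟩⟩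
  have hn' : Nonempty (Fin n) := ⟨⟨0, hn⟩⟩
  have hdeg := hA.sq_degree
  have hsum := hA.sum_mulVec x
  have hsq := hA.mulVec_mulVec_apply x
  simp only [hev, Matrix.mulVec_smul, Pi.smul_apply, smul_eq_mul, ← Finset.mul_sum] at hsum hsq
  simp only [Fintype.card_fin] at hdeg
  by_cases hs : ∑ p, x p = 0
  · right
    by_cases hS : ∀ i, ∑ b, x (i, b) = 0
    · left
      obtain ⟨p, hp⟩ := Function.ne_iff.mp hx
      have h := hsq p
      rw [hS, hs] at h
      exact mul_right_cancel₀ hp (by linear_combination h)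
    · right
      push Not at hS
      obtain ⟨i, hi⟩ := hS
      have h := Finset.sum_congr (rfl : (Finset.univ : Finset (Fin n)) = _)
        fun a _ => hsq (i, a)
      simp only [hs, Finset.sum_add_distrib, Finset.sum_sub_distrib, ← Finset.mul_sum,
        Finset.sum_const, Finset.card_univ, Fintype.card_fin, nsmul_eq_mul] at h
      push_cast
      exact mul_right_cancel₀ hi (by linear_combination h - (∑ b, x (i, b)) * hdeg)
  · left
    exact mul_right_cancel₀ hs hsum
end

section
/- Let A be the adjacency matrix of a proper divisible design graph with parameters (v, k, λ₁, λ₂, m, n), i.e. λ₁ ≠ λ₂. Then A commutes with K = K_{(m,n)}: A·K = K·A. (This expresses that the canonical partition into the m classes of size n is an equitable partition of the graph.) -/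
open Matrix Kronecker

/-- The block-diagonal matrix `K = I_m ⊗ J_n` with `m` diagonal blocks `J_n`. -/
def Kmat (m n : ℕ) : Matrix (Fin m × Fin n) (Fin m × Fin n) ℝ :=
  (1 : Matrix (Fin m) (Fin m) ℝ) ⊗ₖ allOnes (Fin n)

/-- Every row of the adjacency matrix of a divisible design graph sums to the valency. -/
theorem IsDDGAdj.row_sum {cl pt : Type*} [Fintype cl] [DecidableEq cl] [Fintype pt]
    [DecidableEq pt] {k l1 l2 : ℝ} {A : Matrix (cl × pt) (cl × pt) ℝ}
    (hA : IsDDGAdj k l1 l2 A) (x : cl × pt) : ∑ y, A x y = k := by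
  obtain ⟨hsymm, h01, -, hsq⟩ := hA
  have hdiag : (A * A) x x = k := by
    rw [hsq]
    simp [allOnes, Matrix.kroneckerMap_apply]
  rw [← hdiag, Matrix.mul_apply]
  refine Finset.sum_congr rfl fun y _ => ?_
  rw [hsymm.apply x y]
  rcases h01 x y with h | h <;> simp [h]

/-- The adjacency matrix of a divisible design graph commutes with the all-ones matrix. -/
theorem IsDDGAdj.commute_allOnes {cl pt : Type*} [Fintype cl] [DecidableEq cl] [Fintype pt]
    [DecidableEq pt] {k l1 l2 : ℝ} {A : Matrix (cl × pt) (cl × pt) ℝ}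
    (hA : IsDDGAdj k l1 l2 A) : Commute A (allOnes (cl × pt)) := by
  ext x y
  have hcol : ∑ z, A z y = k := by
    rw [← hA.row_sum y]
    exact Finset.sum_congr rfl fun z _ => hA.1.apply y z
  simp only [Matrix.mul_apply, allOnes, Matrix.of_apply, mul_one, one_mul]
  rw [hA.row_sum x, hcol]

/-- The adjacency matrix of a proper divisible design graph commutes with
`K = K_{(m,n)}`: the canonical partition is equitable. -/
theorem ddg_commutes_with_K (m n : ℕ) (hm : 0 < m) (hn : 0 < n)
    (k l1 l2 : ℕ) (A : Matrix (Fin m × Fin n) (Fin m × Fin n) ℝ)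
    (hA : IsDDGAdj (k : ℝ) (l1 : ℝ) (l2 : ℝ) A) (hproper : l1 ≠ l2) :
    A * Kmat m n = Kmat m n * A := by
  have hne : (l1 : ℝ) - l2 ≠ 0 := sub_ne_zero.mpr (Nat.cast_injective.ne hproper)
  have hK : Kmat m n = ((l1 : ℝ) - l2)⁻¹ •
      (A * A - ((k : ℝ) - l1) • (1 : Matrix (Fin m × Fin n) (Fin m × Fin n) ℝ)
        - (l2 : ℝ) • allOnes (Fin m × Fin n)) := by
    rw [eq_inv_smul_iff₀ hne, hA.2.2.2, Kmat]
    module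
  rw [hK]
  exact ((((Commute.refl A).mul_right (Commute.refl A)).sub_right
    ((Commute.one_right A).smul_right _)).sub_right
      (hA.commute_allOnes.smul_right _)).smul_right _
end

section
/- Let A be the adjacency matrix of a divisible design graph with parameters (v, k, λ₁, λ₂, m, n), let S be the v×m characteristic matrix of the canonical partition (S has entry 1 in position ((i,a), j) iff i = j, and 0 otherwise), and let R be an m×m real matrix with A·S = S·R (R is the quotient matrix of the canonical partition). Then R² = (k² − λ₂·v)·I_m + λ₂·n·J_m. -/
open Matrix Kronecker

/-- The characteristic matrix of the canonical partition: entry `((i,a), j)` is `1` iff `i = j`. -/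
def charMatrix (m n : ℕ) : Matrix (Fin m × Fin n) (Fin m) ℝ :=
  Matrix.of fun x j => if x.1 = j then 1 else 0

theorem charMatrix_mul_apply {m n : ℕ} (M : Matrix (Fin m) (Fin m) ℝ) (x : Fin m × Fin n)
    (j : Fin m) : (charMatrix m n * M) x j = M x.1 j := by
  simp [Matrix.mul_apply, charMatrix]

theorem mul_charMatrix_apply {m n : ℕ} (B : Matrix (Fin m × Fin n) (Fin m × Fin n) ℝ)
    (x : Fin m × Fin n) (j : Fin m) : (B * charMatrix m n) x j = ∑ b, B x (j, b) := by
  simp only [Matrix.mul_apply, charMatrix, Matrix.of_apply, Fintype.sum_prod_type, mul_ite,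
    mul_one, mul_zero]
  rw [Finset.sum_comm]
  simp

/-- The square of the adjacency matrix of a divisible design graph, entrywise. -/
theorem IsDDGAdj.mul_self_apply {cl pt : Type*} [Fintype cl] [DecidableEq cl] [Fintype pt]
    [DecidableEq pt] {k l1 l2 : ℝ} {A : Matrix (cl × pt) (cl × pt) ℝ}
    (hA : IsDDGAdj k l1 l2 A) (i j : cl) (a b : pt) :
    (A * A) (i, a) (j, b)
      = (if i = j then (if a = b then k - l1 else 0) + (l1 - l2) else 0) + l2 := by
  rw [hA.2.2.2]
  by_cases hij : i = j <;> by_cases hab : a = b <;>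
    simp [allOnes, hij, hab]

/-- The rows of the square of the adjacency matrix sum to `k ^ 2`. -/
theorem IsDDGAdj.mul_self_row_sum {cl pt : Type*} [Fintype cl] [DecidableEq cl] [Fintype pt]
    [DecidableEq pt] {k l1 l2 : ℝ} {A : Matrix (cl × pt) (cl × pt) ℝ}
    (hA : IsDDGAdj k l1 l2 A) (x : cl × pt) : ∑ y, (A * A) x y = k ^ 2 := by
  simp only [Matrix.mul_apply]
  rw [Finset.sum_comm]
  simp only [← Finset.mul_sum, hA.row_sum, ← Finset.sum_mul, sq]

/-- The sum of a row of the square of the adjacency matrix over one class. -/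
theorem IsDDGAdj.mul_self_class_sum {cl pt : Type*} [Fintype cl] [DecidableEq cl] [Fintype pt]
    [DecidableEq pt] {k l1 l2 : ℝ} {A : Matrix (cl × pt) (cl × pt) ℝ}
    (hA : IsDDGAdj k l1 l2 A) (i j : cl) (a : pt) :
    ∑ b, (A * A) (i, a) (j, b)
      = (if i = j then k - l1 + Fintype.card pt * (l1 - l2) else 0) + Fintype.card pt * l2 := by
  simp only [hA.mul_self_apply]
  by_cases hij : i = j <;> simp [hij, Finset.sum_add_distrib, mul_sub]

/-- The quotient matrix `R` of the canonical partition of a divisible design graph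
satisfies `R² = (k² − λ₂·v)·I_m + λ₂·n·J_m`. -/
theorem ddg_quotient_matrix_square (m n : ℕ) (hm : 0 < m) (hn : 0 < n)
    (k l1 l2 : ℕ) (A : Matrix (Fin m × Fin n) (Fin m × Fin n) ℝ)
    (hA : IsDDGAdj (k : ℝ) (l1 : ℝ) (l2 : ℝ) A)
    (R : Matrix (Fin m) (Fin m) ℝ) (hR : A * charMatrix m n = charMatrix m n * R) :
    R * R = ((k : ℝ) ^ 2 - (l2 : ℝ) * ((m * n : ℕ) : ℝ)) • (1 : Matrix (Fin m) (Fin m) ℝ)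
      + ((l2 : ℝ) * (n : ℝ)) • allOnes (Fin m) := by
  ext i j
  let a : Fin n := ⟨0, hn⟩
  have hsq : A * A * charMatrix m n = charMatrix m n * (R * R) := by
    rw [Matrix.mul_assoc, hR, ← Matrix.mul_assoc, hR, Matrix.mul_assoc]
  have hent := congrFun (congrFun hsq (i, a)) j
  rw [mul_charMatrix_apply, charMatrix_mul_apply, hA.mul_self_class_sum] at hent
  have hrow := hA.mul_self_row_sum (i, a)
  simp only [Fintype.sum_prod_type, hA.mul_self_class_sum, Finset.sum_add_distrib,
    Finset.sum_ite_eq, Finset.mem_univ, if_true, Finset.sum_const, Finset.card_univ,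
    Fintype.card_fin, nsmul_eq_mul] at hrow
  rw [← hent, ← hrow]
  by_cases hij : i = j <;> simp [allOnes, hij] <;> ring
end

section
/- Let A be the adjacency matrix of a proper divisible design graph with parameters (v, k, λ₁, λ₂, m, n), i.e. λ₁ ≠ λ₂, let S be the v×m characteristic matrix of the canonical partition (entry 1 in position ((i,a), j) iff i = j), and let R be an m×m real matrix with A·S = S·R. Then the graph is walk-regular — i.e. for every natural number ℓ the diagonal of A^ℓ is constant (there exists c with (A^ℓ)(x,x) = c for all vertices x) — if and only if R has constant diagonal (there exists a with R(i,i) = a for all i). -/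
open Matrix Kronecker

/-- The block-diagonal matrix `I ⊗ J` with all-ones diagonal blocks. -/
def blockOnes (cl pt : Type*) [DecidableEq cl] : Matrix (cl × pt) (cl × pt) ℝ :=
  (1 : Matrix cl cl ℝ) ⊗ₖ allOnes pt

theorem blockOnes_apply {cl pt : Type*} [DecidableEq cl] (x y : cl × pt) :
    blockOnes cl pt x y = if x.1 = y.1 then 1 else 0 := by
  simp [blockOnes, allOnes, Matrix.one_apply]

section

variable {cl pt : Type*} [Fintype cl] [DecidableEq cl] [Fintype pt]

theorem blockOnes_mul_self :
    blockOnes cl pt * blockOnes cl pt = (Fintype.card pt : ℝ) • blockOnes cl pt := by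
  ext x y
  by_cases h : x.1 = y.1 <;> simp [Matrix.mul_apply, blockOnes_apply, Fintype.sum_prod_type, h]

theorem allOnes_mul_blockOnes :
    allOnes (cl × pt) * blockOnes cl pt = (Fintype.card pt : ℝ) • allOnes (cl × pt) := by
  ext x y
  simp only [Matrix.mul_apply, blockOnes_apply, Fintype.sum_prod_type]
  rw [Finset.sum_comm]
  simp [allOnes]

variable [DecidableEq pt] {k l1 l2 : ℝ} {A : Matrix (cl × pt) (cl × pt) ℝ}

theorem IsDDGAdj.mul_self (hA : IsDDGAdj k l1 l2 A) :
    A * A = (k - l1) • (1 : Matrix (cl × pt) (cl × pt) ℝ) + (l1 - l2) • blockOnes cl pt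
      + l2 • allOnes (cl × pt) := by
  rw [hA.2.2.2, ← blockOnes]
  module

theorem IsDDGAdj.mul_self_apply_self (hA : IsDDGAdj k l1 l2 A) (x : cl × pt) :
    (A * A) x x = k := by
  simp [hA.mul_self, blockOnes_apply, allOnes]

theorem IsDDGAdj.mul_allOnes (hA : IsDDGAdj k l1 l2 A) :
    A * allOnes (cl × pt) = k • allOnes (cl × pt) := by
  ext x y
  have h := hA.mul_self_apply_self x
  rw [Matrix.mul_apply] at h
  have h' : ∀ z, A x z * A z x = A x z := fun z => by
    rw [hA.1.apply x z]
    rcases hA.2.1 x z with h | h <;> simp [h]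
  simp only [h'] at h
  simp [Matrix.mul_apply, allOnes, h]

theorem IsDDGAdj.mul_mul_blockOnes (hA : IsDDGAdj k l1 l2 A) :
    A * (A * blockOnes cl pt) = (k - l1 + (l1 - l2) * Fintype.card pt) • blockOnes cl pt
      + (l2 * Fintype.card pt) • allOnes (cl × pt) := by
  rw [← Matrix.mul_assoc, hA.mul_self, Matrix.add_mul, Matrix.add_mul, Matrix.smul_mul,
    Matrix.smul_mul, Matrix.smul_mul, Matrix.one_mul, blockOnes_mul_self, allOnes_mul_blockOnes]
  module

/-- Every power of `A` lies in the span of `I`, `A`, `K`, `A K` and `J`. -/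
theorem IsDDGAdj.exists_pow_eq (hA : IsDDGAdj k l1 l2 A) (ℓ : ℕ) :
    ∃ p q r s t : ℝ, A ^ ℓ = p • (1 : Matrix (cl × pt) (cl × pt) ℝ) + q • A
      + r • blockOnes cl pt + s • (A * blockOnes cl pt) + t • allOnes (cl × pt) := by
  induction ℓ with
  | zero => exact ⟨1, 0, 0, 0, 0, by simp⟩
  | succ ℓ ih =>
    obtain ⟨p, q, r, s, t, h⟩ := ih
    refine ⟨q * (k - l1), p, q * (l1 - l2) + s * (k - l1 + (l1 - l2) * Fintype.card pt), r,
      q * l2 + s * (l2 * Fintype.card pt) + t * k, ?_⟩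
    rw [pow_succ', h]
    simp only [Matrix.mul_add, Matrix.mul_smul, Matrix.mul_one, hA.mul_self,
      hA.mul_mul_blockOnes, hA.mul_allOnes]
    module

theorem IsDDGAdj.pow_three_apply_self (hA : IsDDGAdj k l1 l2 A) (x : cl × pt) :
    (A ^ 3) x x = (l1 - l2) * (A * blockOnes cl pt) x x + l2 * k := by
  rw [pow_succ', sq, hA.mul_self, Matrix.mul_add, Matrix.mul_add, Matrix.mul_smul,
    Matrix.mul_smul, Matrix.mul_smul, Matrix.mul_one, hA.mul_allOnes]
  simp [hA.2.2.1 x, allOnes]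

end

theorem mul_blockOnes_apply_self {m n : ℕ} {A : Matrix (Fin m × Fin n) (Fin m × Fin n) ℝ}
    {R : Matrix (Fin m) (Fin m) ℝ} (hR : A * charMatrix m n = charMatrix m n * R)
    (x : Fin m × Fin n) : (A * blockOnes (Fin m) (Fin n)) x x = R x.1 x.1 := by
  have h := congrFun (congrFun hR x) x.1
  simp only [Matrix.mul_apply, charMatrix, Matrix.of_apply] at h
  simp only [Matrix.mul_apply, blockOnes_apply, h]
  simp

/-- A proper divisible design graph is walk-regular (for every `ℓ` the diagonal of `A^ℓ`
is constant) if and only if its quotient matrix `R` has constant diagonal. -/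
theorem ddg_walk_regular_iff_quotient_constant_diagonal (m n : ℕ) (hm : 0 < m) (hn : 0 < n)
    (k l1 l2 : ℕ) (A : Matrix (Fin m × Fin n) (Fin m × Fin n) ℝ)
    (hA : IsDDGAdj (k : ℝ) (l1 : ℝ) (l2 : ℝ) A) (hproper : l1 ≠ l2)
    (R : Matrix (Fin m) (Fin m) ℝ) (hR : A * charMatrix m n = charMatrix m n * R) :
    (∀ ℓ : ℕ, ∃ c : ℝ, ∀ x : Fin m × Fin n, (A ^ ℓ) x x = c) ↔
      (∃ a : ℝ, ∀ i : Fin m, R i i = a) := by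
  constructor
  · intro h
    obtain ⟨c, hc⟩ := h 3
    have hl : (l1 : ℝ) - l2 ≠ 0 := sub_ne_zero.mpr (by exact_mod_cast hproper)
    refine ⟨(c - l2 * k) / (l1 - l2), fun i => ?_⟩
    have h3 := hA.pow_three_apply_self (i, ⟨0, hn⟩)
    rw [hc, mul_blockOnes_apply_self hR] at h3
    rw [eq_div_iff hl]
    linarith
  · rintro ⟨a, ha⟩ ℓ
    obtain ⟨p, q, r, s, t, h⟩ := hA.exists_pow_eq ℓ
    refine ⟨p + r + s * a + t, fun x => ?_⟩
    rw [h]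
    simp [mul_blockOnes_apply_self hR, ha, hA.2.2.1 x, blockOnes_apply, allOnes]
end

section
/- Let A' be a symmetric 0-1 m×m matrix with zero diagonal satisfying A'² = k'·I_m + λ'·(J_m − I_m) (i.e. A' is the adjacency matrix of an (m, k', λ')-graph), with 1 ≤ k' < m, and let n ≥ 2. Then A = A' ⊗ J_n satisfies A² = n·k'·I + n·k'·(K − I) + n·λ'·(J − K) where K = I_m ⊗ J_n; that is, A is the adjacency matrix of a divisible design graph with parameters (m·n, n·k', n·k', n·λ', m, n). -/
open Matrix Kronecker

theorem allOnes_mul_self (ι : Type*) [Fintype ι] :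
    allOnes ι * allOnes ι = (Fintype.card ι : ℝ) • allOnes ι := by
  ext i j
  simp [allOnes, mul_apply]

/-- If `A'` is the adjacency matrix of an `(m, k', λ')`-graph with `1 ≤ k' < m` and `n ≥ 2`,
then `A' ⊗ J_n` is the adjacency matrix of a divisible design graph with parameters
`(m·n, n·k', n·k', n·λ', m, n)`. -/
theorem ddg_construction_kronecker_allOnes (m n : ℕ) (hm : 0 < m) (hn : 2 ≤ n)
    (k' l' : ℕ) (hk1 : 1 ≤ k') (hk2 : k' < m)
    (A' : Matrix (Fin m) (Fin m) ℝ)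
    (hsym : A'.IsSymm) (h01 : ∀ i j, A' i j = 0 ∨ A' i j = 1) (hdiag : ∀ i, A' i i = 0)
    (hA' : A' * A' = (k' : ℝ) • (1 : Matrix (Fin m) (Fin m) ℝ)
        + (l' : ℝ) • (allOnes (Fin m) - 1)) :
    IsDDGAdj ((n * k' : ℕ) : ℝ) ((n * k' : ℕ) : ℝ) ((n * l' : ℕ) : ℝ)
      (A' ⊗ₖ allOnes (Fin n)) := by
  refine ⟨?_, ?_, ?_, ?_⟩
  · ext x y
    simpa [allOnes] using hsym.apply x.1 y.1
  · intro x y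
    simpa [allOnes] using h01 x.1 y.1
  · intro x
    simpa [allOnes] using hdiag x.1
  · rw [← mul_kronecker_mul, hA', allOnes_mul_self, Fintype.card_fin]
    ext x y
    simp only [allOnes, kroneckerMap_apply, Matrix.add_apply, Matrix.sub_apply,
      Matrix.smul_apply, of_apply, smul_eq_mul, Nat.cast_mul]
    ring
end

section
/- Let m ≥ 2 and let A₁, …, A_m be symmetric 0-1 n×n matrices with zero diagonal, each satisfying Aᵢ² = k'·I_n + λ'·(J_n − I_n) (adjacency matrices of (n, k', λ')-graphs) with 0 ≤ k' ≤ n − 2. Then A = (J − K) + blockDiagonal(A₁, …, A_m) satisfies A² = k·I + λ₁·(K − I) + λ₂·(J − K) with k = k' + n(m−1), λ₁ = λ' + n(m−1), λ₂ = 2k − v, where v = m·n and K = I_m ⊗ J_n; that is, A is the adjacency matrix of a divisible design graph with parameters (v, k' + n(m−1), λ' + n(m−1), 2k − v, m, n). -/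
open Matrix Kronecker

/-- The block-diagonal matrix built from the family `As` of `n × n` blocks. -/
def blockDiag (m n : ℕ) (As : Fin m → Matrix (Fin n) (Fin n) ℝ) :
    Matrix (Fin m × Fin n) (Fin m × Fin n) ℝ :=
  Matrix.of fun x y => if x.1 = y.1 then As x.1 x.2 y.2 else 0

/-- A symmetric 0-1 matrix has row sums equal to the diagonal entries of its square. -/
theorem row_sum_eq_mul_self_diag {ι : Type*} [Fintype ι] {M : Matrix ι ι ℝ} (hM : M.IsSymm)
    (h01 : ∀ a b, M a b = 0 ∨ M a b = 1) (a : ι) : ∑ b, M a b = (M * M) a a := by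
  rw [Matrix.mul_apply]
  refine Finset.sum_congr rfl fun b _ => ?_
  rw [hM.apply a b]
  rcases h01 a b with h | h <;> simp [h]

theorem allOnes_sub_Kmat_add_blockDiag_apply (m n : ℕ) (As : Fin m → Matrix (Fin n) (Fin n) ℝ)
    (i j : Fin m) (a b : Fin n) :
    (allOnes (Fin m × Fin n) - Kmat m n + blockDiag m n As) (i, a) (j, b) =
      1 + if i = j then As i a b - 1 else 0 := by
  by_cases h : i = j <;> simp [allOnes, Kmat, _root_.blockDiag, h]

/-- The entries of the square, in terms of the row sums of the blocks. -/
theorem sum_one_add_block_mul_one_add_block (m n : ℕ) (As : Fin m → Matrix (Fin n) (Fin n) ℝ)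
    (i j : Fin m) (a b : Fin n) :
    (∑ c, ∑ e, (1 + if i = c then As i a e - 1 else 0) * (1 + if c = j then As c e b - 1 else 0)) =
      (m : ℝ) * n + (∑ e, As i a e - n) + (∑ e, As j e b - n) +
        if i = j then (As i * As j) a b - ∑ e, As i a e - ∑ e, As j e b + n else 0 := by
  have hsplit : ∀ c e,
      (1 + if i = c then As i a e - 1 else 0) * (1 + if c = j then As c e b - 1 else 0) =
        1 + (if i = c then As i a e - 1 else 0) + (if c = j then As c e b - 1 else 0) +
          if i = c then (if i = j then (As i a e - 1) * (As j e b - 1) else 0) else 0 := by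
    intro c e
    split_ifs <;> subst_vars <;> first | contradiction | ring
  simp only [hsplit, Finset.sum_add_distrib]
  congr 1
  · congr 1
    · congr 1
      · simp
      · rw [Finset.sum_comm]
        simp
    · rw [Finset.sum_comm]
      simp
  · rw [Finset.sum_comm]
    simp only [Finset.sum_ite_eq, Finset.mem_univ, if_true]
    by_cases h : i = j
    · simp only [h, if_true, Matrix.mul_apply, sub_mul, mul_sub, Finset.sum_sub_distrib]
      simp
      ring
    · simp [h]

/-- If `A₁, …, A_m` (`m ≥ 2`) are adjacency matrices of `(n, k', λ')`-graphs with
`0 ≤ k' ≤ n − 2`, then `(J − K) + blockDiagonal(A₁, …, A_m)` is the adjacency matrix of a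
divisible design graph with parameters `(v, k' + n(m−1), λ' + n(m−1), 2k − v, m, n)`,
where `v = m·n` and `k = k' + n(m−1)`. -/
theorem ddg_construction_blockdiag (m n : ℕ) (hm : 2 ≤ m) (hn : 0 < n)
    (k' l' : ℕ) (hk : k' + 2 ≤ n)
    (As : Fin m → Matrix (Fin n) (Fin n) ℝ)
    (hsym : ∀ i, (As i).IsSymm)
    (h01 : ∀ i a b, As i a b = 0 ∨ As i a b = 1)
    (hdiag : ∀ i a, As i a a = 0)
    (hAs : ∀ i, As i * As i = (k' : ℝ) • (1 : Matrix (Fin n) (Fin n) ℝ)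
        + (l' : ℝ) • (allOnes (Fin n) - 1)) :
    IsDDGAdj ((k' : ℝ) + (n : ℝ) * ((m : ℝ) - 1)) ((l' : ℝ) + (n : ℝ) * ((m : ℝ) - 1))
      (2 * ((k' : ℝ) + (n : ℝ) * ((m : ℝ) - 1)) - (m : ℝ) * (n : ℝ))
      (allOnes (Fin m × Fin n) - Kmat m n + blockDiag m n As) := by
  have hrow : ∀ i a, ∑ e, As i a e = k' := fun i a => by
    rw [row_sum_eq_mul_self_diag (hsym i) (h01 i), hAs]
    simp [allOnes]
  have hcol : ∀ i b, ∑ e, As i e b = k' := fun i b => by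
    rw [← hrow i b]
    exact Finset.sum_congr rfl fun e _ => (hsym i).apply b e
  refine ⟨?_, ?_, ?_, ?_⟩
  · ext ⟨i, a⟩ ⟨j, b⟩
    rw [Matrix.transpose_apply, allOnes_sub_Kmat_add_blockDiag_apply,
      allOnes_sub_Kmat_add_blockDiag_apply]
    by_cases h : i = j
    · subst h
      simp [(hsym i).apply a b]
    · simp [h, Ne.symm h]
  · rintro ⟨i, a⟩ ⟨j, b⟩
    rw [allOnes_sub_Kmat_add_blockDiag_apply]
    by_cases h : i = j
    · simpa [h] using h01 j a b
    · simp [h]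
  · rintro ⟨i, a⟩
    rw [allOnes_sub_Kmat_add_blockDiag_apply]
    simp [hdiag]
  · ext ⟨i, a⟩ ⟨j, b⟩
    rw [Matrix.mul_apply, Fintype.sum_prod_type]
    simp only [allOnes_sub_Kmat_add_blockDiag_apply]
    rw [sum_one_add_block_mul_one_add_block, hrow, hcol]
    by_cases h : i = j
    · subst h
      rw [hAs]
      by_cases hab : a = b
      · simp [allOnes, hab]
        ring
      · simp [allOnes, hab]
        ring
    · simp [allOnes, h]
      ring
end

section
/- Let m, r ≥ 2, v = m·r, and K = I_m ⊗ J_r. Let A be a symmetric 0-1 v×v matrix with zero diagonal such that A has all entries 0 within the diagonal blocks of K (A ∘ K = 0), A·K = K·A = J − K, and A² = k·I + (μ+2)·A + μ·(J − K − A) for natural numbers k, μ. (These conditions encode that A is the distance-1 adjacency matrix A₁ of an antipodal distance-regular graph of diameter 3 with antipodal classes of size r and λ = μ + 2, the distance-3 matrix being A₃ = K − I.) Then the matrix A + K − I satisfies (A + K − I)² = (k + r − 1)·I + (r − 2)·(K − I) + (μ + 2)·(J − K); that is, A₁ + A₃ is the adjacency matrix of a divisible design graph with parameters (v, k + r − 1,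 r − 2, μ + 2, m, r). -/
open Matrix Kronecker

theorem Kmat_apply (m n : ℕ) (x y : Fin m × Fin n) :
    Kmat m n x y = if x.1 = y.1 then 1 else 0 := by
  simp [Kmat, allOnes, Matrix.one_apply]

theorem Kmat_isSymm (m n : ℕ) : (Kmat m n).IsSymm := by
  ext x y
  simp [Kmat_apply, eq_comm]

theorem Kmat_mul_self (m n : ℕ) : Kmat m n * Kmat m n = (n : ℝ) • Kmat m n := by
  rw [Kmat, ← Matrix.mul_kronecker_mul, allOnes_mul_self, Matrix.kronecker_smul, one_mul,
    Fintype.card_fin]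

/-- If `A` is the distance-1 matrix of an antipodal distance-regular graph of diameter 3
with antipodal classes of size `r` and `λ = μ + 2` (so the distance-3 matrix is `K − I`),
then `A₁ + A₃ = A + K − I` is the adjacency matrix of a divisible design graph with
parameters `(v, k + r − 1, r − 2, μ + 2, m, r)`. -/
theorem ddg_construction_antipodal_drg (m r : ℕ) (hm : 2 ≤ m) (hr : 2 ≤ r)
    (k mu : ℕ)
    (A : Matrix (Fin m × Fin r) (Fin m × Fin r) ℝ)
    (hsym : A.IsSymm) (h01 : ∀ x y, A x y = 0 ∨ A x y = 1) (hdiag : ∀ x, A x x = 0)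
    (hblocks : ∀ (i : Fin m) (a b : Fin r), A (i, a) (i, b) = 0)
    (hAK : A * Kmat m r = allOnes (Fin m × Fin r) - Kmat m r)
    (hKA : Kmat m r * A = allOnes (Fin m × Fin r) - Kmat m r)
    (hA2 : A * A = (k : ℝ) • (1 : Matrix (Fin m × Fin r) (Fin m × Fin r) ℝ)
        + ((mu : ℝ) + 2) • A
        + (mu : ℝ) • (allOnes (Fin m × Fin r) - Kmat m r - A)) :
    IsDDGAdj ((k : ℝ) + (r : ℝ) - 1) ((r : ℝ) - 2) ((mu : ℝ) + 2)
      (A + Kmat m r - 1) := by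
  refine ⟨(hsym.add (Kmat_isSymm m r)).sub Matrix.isSymm_one, ?_, ?_, ?_⟩
  · rintro ⟨i, a⟩ ⟨j, b⟩
    rcases eq_or_ne i j with rfl | hij
    · rcases eq_or_ne a b with rfl | hab
      · simp [Kmat_apply, hdiag]
      · simp [Kmat_apply, hblocks, hab]
    · simpa [Kmat_apply, hij] using h01 (i, a) (j, b)
  · intro x
    simp [Kmat_apply, hdiag]
  · have expand : (A + Kmat m r - 1) * (A + Kmat m r - 1)
        = A * A + A * Kmat m r + Kmat m r * A + Kmat m r * Kmat m r
          - (2 : ℝ) • A - (2 : ℝ) • Kmat m r + 1 := by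
      rw [two_smul, two_smul]
      noncomm_ring
    rw [expand, hA2, hAK, hKA, Kmat_mul_self, ← Kmat]
    module
end

section
/- Let m, n ≥ 2, v = m·n, K = I_m ⊗ J_n, and let c be a natural number with k = c·(m − 1). Let A be a symmetric 0-1 v×v matrix with zero diagonal such that A has all entries 0 within the diagonal blocks of K (A ∘ K = 0), A² = k·I + (μ+2)·A + μ·(J − I − A) for a natural number μ (i.e. A is the adjacency matrix of a strongly regular graph with parameters (v, k, μ+2, μ)), and A·K = K·A = c·(J − K). (These conditions encode that the m classes of size n form a Hoffman coloring of the strongly regular graph.) Then A + K − I satisfies (A + K − I)² = (k + n − 1)·I + (n + μ − 2)·(K − I) + (μ + 2c)·(J − K); that is, A + K − I is the adjacency matrix of a divisible design graph with parameters (mn, k + n − 1, n + μ − 2, μ + 2k/(m−1), m, n). -/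
open Matrix Kronecker

/-- If `A` is the adjacency matrix of a strongly regular graph with parameters
`(v, k, μ+2, μ)` and the `m` classes of size `n` form a Hoffman coloring (each class is a
coclique, and every vertex has exactly `c = k/(m−1)` neighbours in each other class), then
`A + K − I` is the adjacency matrix of a divisible design graph with parameters
`(mn, k + n − 1, n + μ − 2, μ + 2k/(m−1), m, n)`. -/
theorem ddg_construction_hoffman_coloring (m n : ℕ) (hm : 2 ≤ m) (hn : 0 < n)
    (k mu c : ℕ) (hk : k = c * (m - 1))
    (A : Matrix (Fin m × Fin n) (Fin m × Fin n) ℝ)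
    (hsym : A.IsSymm) (h01 : ∀ x y, A x y = 0 ∨ A x y = 1) (hdiag : ∀ x, A x x = 0)
    (hblocks : ∀ (i : Fin m) (a b : Fin n), A (i, a) (i, b) = 0)
    (hsrg : A * A = (k : ℝ) • (1 : Matrix (Fin m × Fin n) (Fin m × Fin n) ℝ)
        + ((mu : ℝ) + 2) • A
        + (mu : ℝ) • (allOnes (Fin m × Fin n) - 1 - A))
    (hAK : A * Kmat m n = (c : ℝ) • (allOnes (Fin m × Fin n) - Kmat m n))
    (hKA : Kmat m n * A = (c : ℝ) • (allOnes (Fin m × Fin n) - Kmat m n)) :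
    IsDDGAdj ((k : ℝ) + (n : ℝ) - 1) ((n : ℝ) + (mu : ℝ) - 2) ((mu : ℝ) + 2 * (c : ℝ))
      (A + Kmat m n - 1) := by
  refine ⟨(hsym.add (Kmat_isSymm m n)).sub Matrix.isSymm_one, ?_, ?_, ?_⟩
  · rintro ⟨i, a⟩ ⟨j, b⟩
    rw [Matrix.sub_apply, Matrix.add_apply, Kmat_apply]
    by_cases hij : i = j
    · subst hij
      rw [hblocks]
      by_cases hab : a = b <;> simp [Matrix.one_apply, hab]
    · simpa [Matrix.one_apply, hij] using h01 (i, a) (j, b)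
  · intro x
    simp [Kmat_apply, hdiag]
  · change _ = _ + _ • (Kmat m n - 1) + _ • (_ - Kmat m n)
    have hexpand : (A + Kmat m n - 1) * (A + Kmat m n - 1) =
        A * A + A * Kmat m n + Kmat m n * A + Kmat m n * Kmat m n
          - (2 : ℝ) • A - (2 : ℝ) • Kmat m n + 1 := by
      simp only [two_smul]
      noncomm_ring
    rw [hexpand, hsrg, hAK, hKA, Kmat_mul_self]
    module
end

section
/- Let m = 2m' be even, v = m·n, K = I_m ⊗ J_n, and let N be a v×v 0-1 matrix with N·Nᵀ = Nᵀ·N = k·I + λ₁·(K − I) + λ₂·(J − K) (the incidence matrix of a symmetric divisible design with parameters (v, k, λ₁, λ₂, m, n)), where k = c·m for a natural number c and K·N = N·K = c·J. Let P = I_{m'} ⊗ ((J₂ − I₂) ⊗ J_n) (the matrix joining the two classes within each pair, the classes being paired consecutively). If 2c = λ₂ (i.e. 2k/m = λ₂), then the 2v×2v matrix A* = [[P, N],[Nᵀ, P]] satisfies A*² = (k + n)·I + (λ₁ + n)·(K* − I) + λ₂·(J* − K*), where K* = I_{2m} ⊗ J_n is the block-diagonal matrix with diagonal blocks K, K and J*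 is the all-ones 2v×2v matrix; that is, A* is the adjacency matrix of a divisible design graph with parameters (2v, k + n, λ₁ + n, λ₂, 2m, n). -/
open Matrix Kronecker

/-- The block-diagonal matrix with `2m'` diagonal blocks `J_n`, the `2m'` classes being
indexed by `Fin m' × Fin 2` (classes paired consecutively). -/
def Kpaired (m' n : ℕ) : Matrix ((Fin m' × Fin 2) × Fin n) ((Fin m' × Fin 2) × Fin n) ℝ :=
  (1 : Matrix (Fin m' × Fin 2) (Fin m' × Fin 2) ℝ) ⊗ₖ allOnes (Fin n)

/-- The matrix `P = I_{m'} ⊗ ((J₂ − I₂) ⊗ J_n)` joining the two classes within each pair. -/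
def Ppair (m' n : ℕ) : Matrix ((Fin m' × Fin 2) × Fin n) ((Fin m' × Fin 2) × Fin n) ℝ :=
  Matrix.of fun x y => if x.1.1 = y.1.1 ∧ x.1.2 ≠ y.1.2 then 1 else 0

/-- The `2v × 2v` matrix `A* = [[P, N], [Nᵀ, P]]`. -/
def sddPairGraph (m' n : ℕ)
    (N : Matrix ((Fin m' × Fin 2) × Fin n) ((Fin m' × Fin 2) × Fin n) ℝ) :
    Matrix ((Fin 2 × (Fin m' × Fin 2)) × Fin n) ((Fin 2 × (Fin m' × Fin 2)) × Fin n) ℝ :=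
  Matrix.of fun x y =>
    if x.1.1 = y.1.1 then Ppair m' n (x.1.2, x.2) (y.1.2, y.2)
    else if x.1.1 = 0 then N (x.1.2, x.2) (y.1.2, y.2)
    else N (y.1.2, y.2) (x.1.2, x.2)

/-- The involution exchanging the two classes of each pair. -/
def swapPair {m' n : ℕ} (x : (Fin m' × Fin 2) × Fin n) : (Fin m' × Fin 2) × Fin n :=
  ((x.1.1, x.1.2.rev), x.2)

theorem Kpaired_apply {m' n : ℕ} (x y : (Fin m' × Fin 2) × Fin n) :
    Kpaired m' n x y = if x.1 = y.1 then 1 else 0 := by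
  simp [Kpaired, allOnes, kroneckerMap_apply, Matrix.one_apply]

theorem Kpaired_swapPair_swapPair {m' n : ℕ} (x y : (Fin m' × Fin 2) × Fin n) :
    Kpaired m' n (swapPair x) (swapPair y) = Kpaired m' n x y := by
  simp [Kpaired_apply, swapPair, Prod.ext_iff]

theorem Ppair_eq_Kpaired_swapPair_left {m' n : ℕ} (x y : (Fin m' × Fin 2) × Fin n) :
    Ppair m' n x y = Kpaired m' n (swapPair x) y := by
  have h : ∀ a b : Fin 2, a.rev = b ↔ a ≠ b := by decide
  simp [Kpaired_apply, Ppair, swapPair, Prod.ext_iff, h]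

theorem Ppair_eq_Kpaired_swapPair_right {m' n : ℕ} (x y : (Fin m' × Fin 2) × Fin n) :
    Ppair m' n x y = Kpaired m' n x (swapPair y) := by
  have h : ∀ a b : Fin 2, a = b.rev ↔ a ≠ b := by decide
  simp [Kpaired_apply, Ppair, swapPair, Prod.ext_iff, h]

theorem Ppair_symm {m' n : ℕ} (x y : (Fin m' × Fin 2) × Fin n) :
    Ppair m' n x y = Ppair m' n y x := by
  simp [Ppair, eq_comm]

theorem Kpaired_mul_self (m' n : ℕ) :
    Kpaired m' n * Kpaired m' n = (n : ℝ) • Kpaired m' n := by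
  have h : allOnes (Fin n) * allOnes (Fin n) = (n : ℝ) • allOnes (Fin n) := by
    ext i j
    simp [allOnes, Matrix.mul_apply]
  rw [Kpaired, ← mul_kronecker_mul, h, one_mul, kronecker_smul]

theorem Ppair_mul_self (m' n : ℕ) :
    Ppair m' n * Ppair m' n = (n : ℝ) • Kpaired m' n := by
  ext x y
  have h := congrFun (congrFun (Kpaired_mul_self m' n) (swapPair x)) (swapPair y)
  rw [Matrix.smul_apply, Kpaired_swapPair_swapPair, Matrix.mul_apply] at h
  rw [Matrix.mul_apply, Matrix.smul_apply, ← h]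
  exact Finset.sum_congr rfl fun z _ => by
    rw [Ppair_eq_Kpaired_swapPair_left x, Ppair_eq_Kpaired_swapPair_right z]

theorem Ppair_mul_apply {m' n : ℕ}
    (N : Matrix ((Fin m' × Fin 2) × Fin n) ((Fin m' × Fin 2) × Fin n) ℝ)
    (x y : (Fin m' × Fin 2) × Fin n) :
    (Ppair m' n * N) x y = (Kpaired m' n * N) (swapPair x) y := by
  simp only [Matrix.mul_apply, Ppair_eq_Kpaired_swapPair_left]

theorem mul_Ppair_apply {m' n : ℕ}
    (N : Matrix ((Fin m' × Fin 2) × Fin n) ((Fin m' × Fin 2) × Fin n) ℝ)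
    (x y : (Fin m' × Fin 2) × Fin n) :
    (N * Ppair m' n) x y = (N * Kpaired m' n) x (swapPair y) := by
  simp only [Matrix.mul_apply, Ppair_eq_Kpaired_swapPair_right]

theorem sum_two_prod_prod {α β : Type*} [Fintype α] [Fintype β]
    (f : (Fin 2 × α) × β → ℝ) :
    ∑ z, f z = ∑ z : α × β, f ((0, z.1), z.2) + ∑ z : α × β, f ((1, z.1), z.2) := by
  simp [Fintype.sum_prod_type, Fin.sum_univ_two]

/-- From a symmetric divisible design with parameters `(v, k, λ₁, λ₂, m, n)`, `m = 2m'`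
even, in which every block contains exactly `c = k/m` points of each class (and dually),
with the classes of points and of blocks split into pairs, provided `2k/m = λ₂`, the graph
`A* = [[P, N], [Nᵀ, P]]` (a point and a block adjacent iff incident; two points, resp.
blocks, adjacent iff their classes form a pair) is a divisible design graph with
parameters `(2v, k + n, λ₁ + n, λ₂, 2m, n)`. -/
theorem ddg_construction_sdd_pairing (m' n : ℕ) (hm : 0 < m') (hn : 0 < n)
    (k l1 l2 c : ℕ) (hk : k = c * (2 * m')) (hc : 2 * c = l2)
    (N : Matrix ((Fin m' × Fin 2) × Fin n) ((Fin m' × Fin 2) × Fin n) ℝ)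
    (h01 : ∀ x y, N x y = 0 ∨ N x y = 1)
    (hNNt : N * Nᵀ = (k : ℝ) • (1 : Matrix ((Fin m' × Fin 2) × Fin n) ((Fin m' × Fin 2) × Fin n) ℝ)
        + (l1 : ℝ) • (Kpaired m' n - 1)
        + (l2 : ℝ) • (allOnes ((Fin m' × Fin 2) × Fin n) - Kpaired m' n))
    (hNtN : Nᵀ * N = (k : ℝ) • (1 : Matrix ((Fin m' × Fin 2) × Fin n) ((Fin m' × Fin 2) × Fin n) ℝ)
        + (l1 : ℝ) • (Kpaired m' n - 1)
        + (l2 : ℝ) • (allOnes ((Fin m' × Fin 2) × Fin n) - Kpaired m' n))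
    (hKN : Kpaired m' n * N = (c : ℝ) • allOnes ((Fin m' × Fin 2) × Fin n))
    (hNK : N * Kpaired m' n = (c : ℝ) • allOnes ((Fin m' × Fin 2) × Fin n)) :
    IsDDGAdj ((k : ℝ) + (n : ℝ)) ((l1 : ℝ) + (n : ℝ)) (l2 : ℝ) (sddPairGraph m' n N) := by
  have hPP (x y) := congrFun (congrFun (Ppair_mul_self m' n) x) y
  have hPN (x y) : (Ppair m' n * N) x y = c := by
    simp [Ppair_mul_apply, hKN, allOnes]
  have hNP (x y) : (N * Ppair m' n) x y = c := by
    simp [mul_Ppair_apply, hNK, allOnes]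
  have hNNt' (x y) := congrFun (congrFun hNNt x) y
  have hNtN' (x y) := congrFun (congrFun hNtN x) y
  have hc' : (l2 : ℝ) = c + c := by rw [← hc]; push_cast; ring
  simp only [Matrix.mul_apply, Matrix.transpose_apply, Matrix.add_apply, Matrix.sub_apply,
    Matrix.smul_apply, smul_eq_mul, Kpaired_apply, Matrix.one_apply, allOnes,
    Matrix.of_apply] at hPP hPN hNP hNNt' hNtN'
  refine ⟨?_, ?_, ?_, ?_⟩
  · ext ⟨⟨i, a⟩, s⟩ ⟨⟨j, b⟩, t⟩
    fin_cases i <;> fin_cases j <;> simp [sddPairGraph, Ppair_symm (a, s)]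
  · rintro ⟨⟨i, a⟩, s⟩ ⟨⟨j, b⟩, t⟩
    have hP : Ppair m' n (a, s) (b, t) = 0 ∨ Ppair m' n (a, s) (b, t) = 1 := by
      rw [Ppair, Matrix.of_apply]
      split_ifs <;> simp
    fin_cases i <;> fin_cases j <;> simp [sddPairGraph, hP, h01]
  · rintro ⟨⟨i, a⟩, s⟩
    simp [sddPairGraph, Ppair]
  · ext ⟨⟨i, a⟩, s⟩ ⟨⟨j, b⟩, t⟩
    have hPN' (x y) : ∑ z, N z x * Ppair m' n z y = c := by
      rw [← hPN y x]
      exact Finset.sum_congr rfl fun z _ => by rw [mul_comm, Ppair_symm]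
    have hNP' (x y) : ∑ z, Ppair m' n x z * N y z = c := by
      rw [← hNP y x]
      exact Finset.sum_congr rfl fun z _ => by rw [mul_comm, Ppair_symm]
    rw [Matrix.mul_apply, sum_two_prod_prod]
    fin_cases i <;> fin_cases j <;> by_cases hab : a = b <;> by_cases hst : s = t <;>
      simp [sddPairGraph, allOnes, kroneckerMap_apply, hPP, hPN, hNP, hPN',
        hNP', hNNt', hNtN', hc', hab, hst] <;>
      ring
end

section
/- Let t ≥ 1 and let W₊, W₋ be symmetric 0-1 matrices of size 4t×4t with W₊ + W₋ = J_{4t} − I_t ⊗ J₄ and (W₊ − W₋)² = 4(t − 1)·I_{4t}. Let A = W₊ ⊗ I₂ + W₋ ⊗ (J₂ − I₂) + I_t ⊗ (I₂ ⊗ ((J₂ − I₂) ⊗ J₂)) (this is the graph of Construction 20 with the edges of a complete bipartite subgraph K_{4,4} removed from each of the t complete multipartite diagonal parts, leaving within each part only the edges joining the two classes of each pair). Then A satisfies A² = (4t − 2)·I + 2·(K − I) + (2t − 2)·(J − K), where K = I_{4t} ⊗ J₂ and J is the all-ones 8t×8t matrix; that is, A is the adjacency matrix of a divisible design graph with parameters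 (8t, 4t − 2, 2, 2t − 2, 4t, 2). -/
open Matrix Kronecker

/-- The matrix `I_t ⊗ (I₂ ⊗ ((J₂ − I₂) ⊗ J₂))`: within each of the `t` groups of four
classes the four classes are split into the two consecutive pairs `{0,1}` and `{2,3}`,
and all vertices of the two distinct classes of each pair are joined. -/
def pairedPart (t : ℕ) :
    Matrix ((Fin t × Fin 4) × Fin 2) ((Fin t × Fin 4) × Fin 2) ℝ :=
  Matrix.of fun x y =>
    if x.1.1 = y.1.1 ∧ x.1.2 ≠ y.1.2 ∧ (x.1.2 : ℕ) / 2 = (y.1.2 : ℕ) / 2 then 1 else 0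

theorem allOnes_apply {ι : Type*} (i j : ι) : allOnes ι i j = 1 := rfl

theorem allOnes_isSymm (ι : Type*) : (allOnes ι).IsSymm := rfl

theorem allOnes_prod (ι κ : Type*) : allOnes (ι × κ) = allOnes ι ⊗ₖ allOnes κ := by
  ext i j
  simp [allOnes_apply]

/-- The permutation matrix of the involution of `Fin 4` that swaps `0` with `1` and `2` with `3`. -/
def pairSwap : Matrix (Fin 4) (Fin 4) ℝ :=
  Matrix.of fun a b => if a ≠ b ∧ (a : ℕ) / 2 = (b : ℕ) / 2 then 1 else 0

theorem pairSwap_mul_self : pairSwap * pairSwap = 1 := by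
  ext i j
  fin_cases i <;> fin_cases j <;> simp [Matrix.mul_apply, Fin.sum_univ_four, pairSwap]

theorem allOnes_mul_pairSwap : allOnes (Fin 4) * pairSwap = allOnes (Fin 4) := by
  ext i j
  simp only [Matrix.mul_apply, Fin.sum_univ_four, allOnes_apply]
  fin_cases j <;> simp [pairSwap]

theorem pairSwap_isSymm : pairSwap.IsSymm := by
  ext i j
  simp only [Matrix.transpose_apply, pairSwap, Matrix.of_apply]
  congr 1
  exact propext (and_congr ne_comm eq_comm)

theorem pairSwap_mul_allOnes : pairSwap * allOnes (Fin 4) = allOnes (Fin 4) := by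
  simpa [Matrix.transpose_mul, pairSwap_isSymm.eq, (allOnes_isSymm _).eq] using
    congrArg Matrix.transpose allOnes_mul_pairSwap

theorem kronecker_two_smul_one_sub {ι : Type*} (B : Matrix ι ι ℝ) :
    B ⊗ₖ ((2 : ℝ) • (1 : Matrix (Fin 2) (Fin 2) ℝ) - allOnes (Fin 2))
      = (2 : ℝ) • (B ⊗ₖ 1) - B ⊗ₖ allOnes (Fin 2) := by
  ext x y
  simp
  ring

theorem pairedPart_eq_kronecker (t : ℕ) :
    pairedPart t = ((1 : Matrix (Fin t) (Fin t) ℝ) ⊗ₖ pairSwap) ⊗ₖ allOnes (Fin 2) := by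
  ext x y
  by_cases h : x.1.1 = y.1.1 <;>
    simp [pairedPart, pairSwap, allOnes_apply, Matrix.one_apply, h]

/-- The square of the quotient matrix `J - I ⊗ J₄ + 2 (I ⊗ pairSwap)`. -/
theorem quotient_mul_self (t : ℕ) :
    (allOnes (Fin t × Fin 4) - (1 : Matrix (Fin t) (Fin t) ℝ) ⊗ₖ allOnes (Fin 4)
        + (2 : ℝ) • ((1 : Matrix (Fin t) (Fin t) ℝ) ⊗ₖ pairSwap))
      * (allOnes (Fin t × Fin 4) - (1 : Matrix (Fin t) (Fin t) ℝ) ⊗ₖ allOnes (Fin 4)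
        + (2 : ℝ) • ((1 : Matrix (Fin t) (Fin t) ℝ) ⊗ₖ pairSwap))
      = (4 * (t : ℝ) - 4) • allOnes (Fin t × Fin 4) + (4 : ℝ) • 1 := by
  simp only [allOnes_prod, add_mul, mul_add, sub_mul, mul_sub, Matrix.smul_mul, Matrix.mul_smul,
    ← Matrix.mul_kronecker_mul, allOnes_mul_self, allOnes_mul_pairSwap, pairSwap_mul_allOnes,
    pairSwap_mul_self, one_mul, mul_one, Matrix.smul_kronecker, Matrix.kronecker_smul,
    Matrix.one_kronecker_one, Fintype.card_fin, Nat.cast_ofNat]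
  module

/-- Split a matrix of `2 × 2` circulant blocks along the two eigenspaces of `J₂`. -/
theorem kronecker_one_add_kronecker_compl {ι : Type*} (P M Q : Matrix ι ι ℝ) :
    P ⊗ₖ (1 : Matrix (Fin 2) (Fin 2) ℝ) + M ⊗ₖ (allOnes (Fin 2) - 1) + Q ⊗ₖ allOnes (Fin 2)
      = (1 / 2 : ℝ) • ((P + M + (2 : ℝ) • Q) ⊗ₖ allOnes (Fin 2)
          + (P - M) ⊗ₖ ((2 : ℝ) • 1 - allOnes (Fin 2))) := by
  ext x y
  simp [allOnes_apply]
  ring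

theorem split_mul_self {ι : Type*} [Fintype ι] (S D : Matrix ι ι ℝ) :
    ((1 / 2 : ℝ) • (S ⊗ₖ allOnes (Fin 2) + D ⊗ₖ ((2 : ℝ) • 1 - allOnes (Fin 2))))
      * ((1 / 2 : ℝ) • (S ⊗ₖ allOnes (Fin 2) + D ⊗ₖ ((2 : ℝ) • 1 - allOnes (Fin 2))))
      = (1 / 2 : ℝ) • ((S * S) ⊗ₖ allOnes (Fin 2)
          + (D * D) ⊗ₖ ((2 : ℝ) • 1 - allOnes (Fin 2))) := by
  have h₁ : allOnes (Fin 2) * ((2 : ℝ) • 1 - allOnes (Fin 2)) = 0 := by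
    simp [mul_sub, allOnes_mul_self]
  have h₂ : ((2 : ℝ) • 1 - allOnes (Fin 2)) * allOnes (Fin 2) = 0 := by
    simp [sub_mul, allOnes_mul_self]
  have h₃ : ((2 : ℝ) • 1 - allOnes (Fin 2)) * ((2 : ℝ) • 1 - allOnes (Fin 2))
      = (2 : ℝ) • ((2 : ℝ) • 1 - allOnes (Fin 2)) := by
    rw [sub_mul, h₁, sub_zero, Matrix.smul_mul, one_mul]
  simp only [add_mul, mul_add, Matrix.smul_mul, Matrix.mul_smul, ← Matrix.mul_kronecker_mul,
    h₁, h₂, h₃, allOnes_mul_self, Matrix.kronecker_zero, Matrix.kronecker_smul,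
    Fintype.card_fin, Nat.cast_ofNat]
  module

/-- Removing the edges of a complete bipartite subgraph `K_{4,4}` from each complete
multipartite diagonal part of the graph of the weighing-matrix construction yields the
adjacency matrix of a divisible design graph with parameters `(8t, 4t − 2, 2, 2t − 2, 4t, 2)`. -/
theorem ddg_construction_weighing_removed (t : ℕ) (ht : 1 ≤ t)
    (Wp Wm : Matrix (Fin t × Fin 4) (Fin t × Fin 4) ℝ)
    (hWpSym : Wp.IsSymm) (hWmSym : Wm.IsSymm)
    (hWp01 : ∀ x y, Wp x y = 0 ∨ Wp x y = 1)
    (hWm01 : ∀ x y, Wm x y = 0 ∨ Wm x y = 1)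
    (hsupp : Wp + Wm = allOnes (Fin t × Fin 4)
        - (1 : Matrix (Fin t) (Fin t) ℝ) ⊗ₖ allOnes (Fin 4))
    (hW : (Wp - Wm) * (Wp - Wm)
        = (4 * ((t : ℝ) - 1)) • (1 : Matrix (Fin t × Fin 4) (Fin t × Fin 4) ℝ)) :
    IsDDGAdj (4 * (t : ℝ) - 2) 2 (2 * (t : ℝ) - 2)
      (Wp ⊗ₖ (1 : Matrix (Fin 2) (Fin 2) ℝ) + Wm ⊗ₖ (allOnes (Fin 2) - 1)
        + pairedPart t) := by
  have hentry : ∀ a b, Wp a b + Wm a b = if a.1 = b.1 then 0 else 1 := by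
    intro a b
    have h := congrFun (congrFun hsupp a) b
    by_cases hab : a.1 = b.1 <;>
      simpa [allOnes_apply, Matrix.one_apply, hab] using h
  have hzero : ∀ a b, a.1 = b.1 → Wp a b = 0 ∧ Wm a b = 0 := by
    intro a b hab
    have h := hentry a b
    rw [if_pos hab] at h
    rcases hWp01 a b with hp | hp <;> rcases hWm01 a b with hm | hm <;>
      constructor <;> linarith
  refine ⟨?_, ?_, ?_, ?_⟩
  · rw [pairedPart_eq_kronecker]
    simp only [Matrix.IsSymm, Matrix.transpose_add, Matrix.transpose_sub, Matrix.transpose_one,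
      ← Matrix.kroneckerMap_transpose, hWpSym.eq, hWmSym.eq, pairSwap_isSymm.eq,
      (allOnes_isSymm _).eq]
  · intro x y
    by_cases hxy : x.1.1 = y.1.1
    · obtain ⟨hp, hm⟩ := hzero _ _ hxy
      simp only [Matrix.add_apply, Matrix.kroneckerMap_apply, hp, hm, zero_mul, zero_add,
        pairedPart, Matrix.of_apply]
      split_ifs <;> simp
    · have h := hentry x.1 y.1
      rw [if_neg hxy] at h
      rcases hWp01 x.1 y.1 with hp | hp
      · have hm : Wm x.1 y.1 = 1 := by linarith
        by_cases h2 : x.2 = y.2 <;>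
          simp [pairedPart, hp, hm, hxy, allOnes_apply, Matrix.one_apply, h2]
      · have hm : Wm x.1 y.1 = 0 := by linarith
        by_cases h2 : x.2 = y.2 <;>
          simp [pairedPart, hp, hm, hxy, Matrix.one_apply, h2]
  · intro x
    obtain ⟨hp, hm⟩ := hzero x.1 x.1 rfl
    simp [pairedPart, hp, hm]
  · rw [pairedPart_eq_kronecker, kronecker_one_add_kronecker_compl, split_mul_self, hsupp, hW,
      quotient_mul_self, allOnes_prod (Fin t × Fin 4)]
    simp only [Matrix.add_kronecker, Matrix.smul_kronecker,
      kronecker_two_smul_one_sub, Matrix.one_kronecker_one]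
    module
end

section
/- Let T₁, T₂, T₃ be the 3×3 permutation matrices T₁ = [[1,0,0],[0,0,1],[0,1,0]], T₂ = [[0,1,0],[1,0,0],[0,0,1]], T₃ = [[0,0,1],[0,1,0],[1,0,0]], and with J = J₃, I = I₃, O = O₃ let M be the 27×27 matrix given in 9×9 block form by rows: (O, J−I, J−I, J−I, J−I, O, O, O, O), (J−I, O, T₁, T₂, T₃, J, O, O, O), (J−I, T₁, O, T₃, T₂, O, J, O, O), (J−I, T₂, T₃, O, T₁, O, O, J, O), (J−I, T₃, T₂, T₁, O, O, O, O, J), (O, J, O, O, O, J−I, I, I, I), (O, O, J, O, O, I, J−I, I, I), (O, O, O, J, O, I, I, J−I, I), (O, O, O, O, J, I, I, I, J−I). Then M is a symmetric 0-1 matrix with zero diagonal satisfying M² = 8·I₂₇ + 4·(K − I₂₇) + 2·(J₂₇ − K) with K = I₉ ⊗ J₃; that is, M is the adjacency matrix of a divisible design graph with parameters (27, 8, 4, 2, 9, 3). -/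
open Matrix Kronecker

def T1 : Matrix (Fin 3) (Fin 3) ℝ := !![1,0,0; 0,0,1; 0,1,0]
def T2 : Matrix (Fin 3) (Fin 3) ℝ := !![0,1,0; 1,0,0; 0,0,1]
def T3 : Matrix (Fin 3) (Fin 3) ℝ := !![0,0,1; 0,1,0; 1,0,0]

/-- The `9 × 9` array of `3 × 3` blocks of the sporadic `(27, 8, 4, 2, 9, 3)` construction. -/
def blocks27 : Fin 9 → Fin 9 → Matrix (Fin 3) (Fin 3) ℝ :=
  let J := allOnes (Fin 3)
  let I : Matrix (Fin 3) (Fin 3) ℝ := 1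
  ![![0, J-I, J-I, J-I, J-I, 0, 0, 0, 0],
    ![J-I, 0, T1, T2, T3, J, 0, 0, 0],
    ![J-I, T1, 0, T3, T2, 0, J, 0, 0],
    ![J-I, T2, T3, 0, T1, 0, 0, J, 0],
    ![J-I, T3, T2, T1, 0, 0, 0, 0, J],
    ![0, J, 0, 0, 0, J-I, I, I, I],
    ![0, 0, J, 0, 0, I, J-I, I, I],
    ![0, 0, 0, J, 0, I, I, J-I, I],
    ![0, 0, 0, 0, J, I, I, I, J-I]]

/-- The sporadic `27 × 27` matrix `M`. -/
def M27 : Matrix (Fin 9 × Fin 3) (Fin 9 × Fin 3) ℝ :=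
  Matrix.of fun x y => blocks27 x.1 y.1 x.2 y.2

theorem allOnes_mul_allOnes : allOnes (Fin 3) * allOnes (Fin 3) = (3 : ℝ) • allOnes (Fin 3) := by
  ext a b; simp [allOnes, Matrix.mul_apply]

theorem T_mul_allOnes : T1 * allOnes (Fin 3) = allOnes (Fin 3) ∧
    T2 * allOnes (Fin 3) = allOnes (Fin 3) ∧ T3 * allOnes (Fin 3) = allOnes (Fin 3) := by
  refine ⟨?_, ?_, ?_⟩ <;> ext a b <;> fin_cases a <;>
    simp [T1, T2, T3, allOnes, Matrix.mul_apply, Fin.sum_univ_three]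

theorem allOnes_mul_T : allOnes (Fin 3) * T1 = allOnes (Fin 3) ∧
    allOnes (Fin 3) * T2 = allOnes (Fin 3) ∧ allOnes (Fin 3) * T3 = allOnes (Fin 3) := by
  refine ⟨?_, ?_, ?_⟩ <;> ext a b <;> fin_cases b <;>
    simp [T1, T2, T3, allOnes, Matrix.mul_apply, Fin.sum_univ_three]

theorem T_mul_self : T1 * T1 = 1 ∧ T2 * T2 = 1 ∧ T3 * T3 = 1 := by
  simp [T1, T2, T3, Matrix.one_fin_three]

theorem T_mul_T : T2 * T3 = T1 * T2 ∧ T3 * T1 = T1 * T2 ∧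
    T3 * T2 = T2 * T1 ∧ T1 * T3 = T2 * T1 := by
  simp [T1, T2, T3]

theorem T1_add_T2_add_T3 : T1 + T2 + T3 = allOnes (Fin 3) := by
  ext a b; fin_cases a <;> fin_cases b <;> simp [T1, T2, T3, allOnes]

theorem one_add_T1_mul_T2_add_T2_mul_T1 : 1 + T1 * T2 + T2 * T1 = allOnes (Fin 3) := by
  ext a b; fin_cases a <;> fin_cases b <;> simp [T1, T2, allOnes]

theorem T_transpose : T1ᵀ = T1 ∧ T2ᵀ = T2 ∧ T3ᵀ = T3 := by
  refine ⟨?_, ?_, ?_⟩ <;> ext a b <;> fin_cases a <;> fin_cases b <;> simp [T1, T2, T3]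

theorem T_apply_eq_zero_or_one (a b : Fin 3) :
    (T1 a b = 0 ∨ T1 a b = 1) ∧ (T2 a b = 0 ∨ T2 a b = 1) ∧ (T3 a b = 0 ∨ T3 a b = 1) := by
  fin_cases a <;> fin_cases b <;> simp [T1, T2, T3]

theorem allOnes_transpose : (allOnes (Fin 3))ᵀ = allOnes (Fin 3) := rfl

theorem blocks27_transpose (i j : Fin 9) : (blocks27 i j)ᵀ = blocks27 j i := by
  obtain ⟨h1, h2, h3⟩ := T_transpose
  fin_cases i <;> fin_cases j <;> simp [blocks27, h1, h2, h3, allOnes_transpose]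

theorem blocks27_cases (i j : Fin 9) :
    blocks27 i j = 0 ∨ blocks27 i j = 1 ∨ blocks27 i j = allOnes (Fin 3) ∨
      blocks27 i j = allOnes (Fin 3) - 1 ∨ blocks27 i j = T1 ∨ blocks27 i j = T2 ∨
      blocks27 i j = T3 := by
  fin_cases i <;> fin_cases j <;> simp [blocks27]

theorem blocks27_apply_eq_zero_or_one (i j : Fin 9) (a b : Fin 3) :
    blocks27 i j a b = 0 ∨ blocks27 i j a b = 1 := by
  obtain ⟨h1, h2, h3⟩ := T_apply_eq_zero_or_one a b
  rcases blocks27_cases i j with h | h | h | h | h | h | h <;> rw [h]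
  · simp
  · by_cases hab : a = b <;> simp [Matrix.one_apply, hab]
  · simp [allOnes]
  · by_cases hab : a = b <;> simp [allOnes, hab]
  · exact h1
  · exact h2
  · exact h3

theorem blocks27_self (i : Fin 9) : blocks27 i i = 0 ∨ blocks27 i i = allOnes (Fin 3) - 1 := by
  fin_cases i <;> simp [blocks27]

theorem blocks27_diag (i : Fin 9) (a : Fin 3) : blocks27 i i a a = 0 := by
  rcases blocks27_self i with h | h <;> simp [h, allOnes]

theorem sum_blocks27_mul_blocks27 (i j : Fin 9) :
    ∑ k, blocks27 i k * blocks27 k j =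
      if i = j then (4 : ℝ) • 1 + (4 : ℝ) • allOnes (Fin 3) else (2 : ℝ) • allOnes (Fin 3) := by
  obtain ⟨hT1J, hT2J, hT3J⟩ := T_mul_allOnes
  obtain ⟨hJT1, hJT2, hJT3⟩ := allOnes_mul_T
  obtain ⟨h11, h22, h33⟩ := T_mul_self
  obtain ⟨h23, h31, h32, h13⟩ := T_mul_T
  have h3 : T3 = allOnes (Fin 3) - T1 - T2 := by rw [← T1_add_T2_add_T3]; abel
  have h21 : T2 * T1 = allOnes (Fin 3) - 1 - T1 * T2 := by
    rw [← one_add_T1_mul_T2_add_T2_mul_T1]; abel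
  fin_cases i <;> fin_cases j <;>
    simp [blocks27, Fin.sum_univ_succ, mul_sub, sub_mul, allOnes_mul_allOnes, hT1J, hT2J, hT3J,
      hJT1, hJT2, hJT3, h11, h22, h33, h23, h31, h32, h13, h21] <;>
    (try rw [h3]) <;> module

/-- The matrix `M27` is a symmetric 0-1 matrix with zero diagonal satisfying
`M² = 8·I + 4·(K − I) + 2·(J − K)` with `K = I₉ ⊗ J₃`; that is, `M27` is the adjacency
matrix of a divisible design graph with parameters `(27, 8, 4, 2, 9, 3)`. -/
theorem ddg_sporadic_27 : IsDDGAdj (8 : ℝ) (4 : ℝ) (2 : ℝ) M27 := by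
  refine ⟨?_, fun x y => blocks27_apply_eq_zero_or_one x.1 y.1 x.2 y.2,
    fun x => blocks27_diag x.1 x.2, ?_⟩
  · ext x y
    exact congrFun (congrFun (blocks27_transpose y.1 x.1) x.2) y.2
  · ext ⟨i, a⟩ ⟨j, b⟩
    have h : (M27 * M27) (i, a) (j, b) = (∑ k, blocks27 i k * blocks27 k j) a b := by
      simp only [Matrix.mul_apply, Matrix.sum_apply, Fintype.sum_prod_type, M27, Matrix.of_apply]
    rw [h, sum_blocks27_mul_blocks27]
    by_cases hij : i = j
    · by_cases hab : a = b
      · simp [allOnes, hij, hab]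
        norm_num
      · simp [allOnes, hij, hab]
    · simp [allOnes, hij]
end
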